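/- Superposition operators, analytic case: Let Ω ⊆ ℝⁿ be an open set satisfying the cone property, let ρ > 0, and let f : 𝓑^ρ_{ℂ^d}(0) → ℂ^d be analytic; if Ω is unbounded assume f(0) = 0. Then for every ℓ > n/2 the superposition operator u ↦ f(u) is analytic as a map from the closed ball of radius R around 0 in H_ℓ(Ω;ℂ^d) to H_ℓ(Ω;ℂ^d) for every R ≤ ρ/c, where c = c(ℓ) is the algebra constant with ‖uv‖_{H_ℓ} ≤ c‖u‖_{H_ℓ}‖v‖_{H_ℓ}; moreover f and its derivatives up to order N are bounded on this ball, with N-dependent bounds, for arbitrary N ∈ ℕ. -/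

import Mathlib

open Set Metric

noncomputable section

/-- `CbBound k F s C` formalises membership of `F` in `C_b^k(s; Z)` with bound `C`:
`F` is `k` times continuously differentiable on the interior of `s`, extends
continuously to `s`, and `F` together with its derivatives of order `≤ k` is
bounded by `C` on the interior of `s`. -/
def CbBound {X Z : Type*} [NormedAddCommGroup X] [NormedSpace ℝ X]
    [NormedAddCommGroup Z] [NormedSpace ℝ Z]
    (k : ℕ) (F : X → Z) (s : Set X) (C : ℝ) : Prop :=
  ContDiffOn ℝ k F (interior s) ∧ ContinuousOn F s ∧
    ∀ i : ℕ, i ≤ k → ∀ x ∈ interior s, ‖iteratedFDerivWithin ℝ i F (interior s) x‖ ≤ C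

/-- `Ω ⊆ ℝⁿ` satisfies the cone property: there is a fixed (solid, finite) cone of
opening ratio `r > 0` and height `h > 0` such that every point of `Ω` is the vertex
of a congruent cone contained in `Ω`. -/
def HasConeProperty {n : ℕ} (Ω : Set (EuclideanSpace ℝ (Fin n))) : Prop :=
  ∃ r h : ℝ, 0 < r ∧ 0 < h ∧ ∀ x ∈ Ω, ∃ v : EuclideanSpace ℝ (Fin n), ‖v‖ = 1 ∧
    {y : EuclideanSpace ℝ (Fin n) | ∃ t ∈ Ioc (0 : ℝ) h, ‖y - x - t • v‖ ≤ r * t} ⊆ Ω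

theorem aux_extend {E G : Type*} [NormedAddCommGroup E] [NormedSpace ℂ E] [ProperSpace E]
    [NormedAddCommGroup G] [NormedSpace ℂ G] [CompleteSpace G]
    (f : E → G) (ρ : ℝ) (hρ : 0 < ρ) (hf : AnalyticOn ℂ f (closedBall 0 ρ)) :
    ∃ ρ' > ρ, ∃ g : E → G, AnalyticOnNhd ℂ g (ball 0 ρ') ∧ ∀ z ∈ closedBall (0:E) ρ, g z = f z := by
  have h1 : ∀ x : closedBall (0:E) ρ, ∃ g : E → G, ∃ U : Set E, IsOpen U ∧ (x:E) ∈ U ∧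
      AnalyticOnNhd ℂ g U ∧ ∀ z ∈ U ∩ closedBall 0 ρ, f z = g z := by
    intro x
    obtain ⟨g, hg, hga⟩ := analyticWithinAt_iff_exists_analyticAt.1 (hf x x.2)
    rw [insert_eq_of_mem x.2] at hg
    obtain ⟨V, hV, hVo, hxV⟩ := _root_.eventually_nhds_iff.1 hga.eventually_analyticAt
    obtain ⟨W, hW, hWo, hxW⟩ := _root_.eventually_nhds_iff.1 (eventually_nhdsWithin_iff.1 hg)
    exact ⟨g, V ∩ W, hVo.inter hWo, ⟨hxV, hxW⟩, fun y hy => hV y hy.1, fun z hz => hW z hz.1.2 hz.2⟩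
  choose G0 U hUo hxU hGU hfG using h1
  obtain ⟨δ, hδ, hδ'⟩ := lebesgue_number_lemma_of_metric (isCompact_closedBall (0:E) ρ) hUo
    (fun x hx => mem_iUnion.2 ⟨⟨x, hx⟩, hxU ⟨x, hx⟩⟩)
  have h2 : ∀ x : E, ∃ g : E → G, x ∈ closedBall (0:E) ρ → AnalyticOnNhd ℂ g (ball x δ) ∧
      ∀ z ∈ ball x δ ∩ closedBall 0 ρ, f z = g z := by
    intro x
    by_cases hx : x ∈ closedBall (0:E) ρ
    · obtain ⟨i, hi⟩ := hδ' x hx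
      exact ⟨G0 i, fun _ => ⟨(hGU i).mono hi, fun z hz => hfG i z ⟨hi hz.1, hz.2⟩⟩⟩
    · exact ⟨f, fun h => absurd h hx⟩
  choose g hg using h2
  have hρδ : 0 < ρ + δ := by positivity
  set s : ℝ := ρ / (ρ + δ) with hs
  have hs0 : 0 < s := by positivity
  have hs1 : s < 1 := (div_lt_one hρδ).2 (by linarith)
  have hs2 : s * (ρ + δ) = ρ := by rw [hs]; field_simp
  let π : E → E := fun z => (s : ℂ) • z
  have hπc : Continuous π := by fun_prop
  have hπn : ∀ z, ‖π z‖ = s * ‖z‖ := fun z => by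
    simp [π, norm_smul, abs_of_pos hs0]
  have hπ : ∀ z ∈ ball (0:E) (ρ+δ), π z ∈ ball (0:E) ρ := by
    intro z hz
    rw [mem_ball_zero_iff] at hz ⊢
    rw [hπn, ← hs2]; gcongr
  have hπz : ∀ z ∈ ball (0:E) (ρ+δ), z ∈ ball (π z) δ := by
    intro z hz
    rw [mem_ball_zero_iff] at hz
    rw [mem_ball, dist_eq_norm]
    have : z - π z = ((1 - s : ℝ) : ℂ) • z := by simp [π, sub_smul]
    rw [this, norm_smul, Complex.norm_real, Real.norm_eq_abs, abs_of_pos (by linarith)]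
    nlinarith
  refine ⟨ρ + δ, by linarith, fun z => g (π z) z, ?_, ?_⟩
  · intro z0 hz0
    have hx0 := hπ z0 hz0
    have hA := hg (π z0) (ball_subset_closedBall hx0)
    refine (hA.1 z0 (hπz z0 hz0)).congr ?_
    have e1 : ∀ᶠ z in nhds z0, z ∈ ball (0:E) (ρ+δ) := isOpen_ball.mem_nhds hz0
    have e2 : ∀ᶠ z in nhds z0, z ∈ ball (π z0) δ := isOpen_ball.mem_nhds (hπz z0 hz0)
    have e3 : ∀ᶠ z in nhds z0, π z ∈ ball (π z0) δ :=
      hπc.continuousAt (isOpen_ball.mem_nhds (mem_ball_self hδ))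
    filter_upwards [e1, e2, e3] with z m1 m2 m3
    have hB := hg (π z) (ball_subset_closedBall (hπ z m1))
    have hm : π z0 ∈ ball (π z) δ := by rwa [mem_ball_comm]
    refine (hA.1.mono inter_subset_left).eqOn_of_preconnected_of_eventuallyEq
      (hB.1.mono inter_subset_right)
      ((convex_ball (π z0) δ).inter (convex_ball (π z) δ)).isPreconnected
      (z₀ := π z0) ⟨mem_ball_self hδ, hm⟩ ?_ ⟨m2, hπz z m1⟩
    filter_upwards [isOpen_ball.mem_nhds hx0, isOpen_ball.mem_nhds (mem_ball_self (x := π z0) hδ),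
      isOpen_ball.mem_nhds hm] with y y1 y2 y3
    rw [← hA.2 y ⟨y2, ball_subset_closedBall y1⟩, ← hB.2 y ⟨y3, ball_subset_closedBall y1⟩]
  · intro z hz
    have hz' : z ∈ ball (0:E) (ρ+δ) := closedBall_subset_ball (by linarith) hz
    exact ((hg (π z) (ball_subset_closedBall (hπ z hz'))).2 z ⟨hπz z hz', hz⟩).symm

theorem aux_summable (d : ℕ) (q : Fin d → ℝ) (h0 : ∀ i, 0 ≤ q i) (h1 : ∀ i, q i < 1) :
    Summable (fun α : Fin d → ℕ => ∏ i, q i ^ α i) := by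
  induction d with
  | zero => exact Summable.of_finite
  | succ d ih =>
    rw [← (Fin.consEquiv (fun _ => ℕ)).summable_iff]
    have := (summable_geometric_of_lt_one (h0 0) (h1 0)).mul_of_nonneg
      (ih (fun i => q i.succ) (fun i => h0 _) (fun i => h1 _))
      (fun n => pow_nonneg (h0 0) n) (fun α => Finset.prod_nonneg fun i _ => pow_nonneg (h0 _) _)
    refine this.congr fun x => ?_
    simp [Fin.consEquiv, Fin.prod_univ_succ]

theorem aux_coeff (r M : ℝ) (hr : 0 < r) (d : ℕ) (g : (Fin d → ℂ) → ℂ)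
    (hg : AnalyticOnNhd ℂ g (ball 0 r)) (hM : ∀ z ∈ ball 0 r, ‖g z‖ ≤ M) :
    ∃ a : (Fin d → ℕ) → ℂ, (∀ α, ‖a α‖ * r ^ (∑ i, α i) ≤ M) ∧
      ∀ z ∈ ball 0 r, HasSum (fun α => a α * ∏ i, z i ^ α i) (g z) := by
  induction d generalizing M with
  | zero =>
    refine ⟨fun _ => g 0, fun α => by simpa using hM 0 (by simpa), fun z hz => ?_⟩
    have : z = 0 := Subsingleton.elim _ _
    subst this
    simp
  | succ d ih =>
    have hcons : ∀ (w : ℂ) (z : Fin d → ℂ), Fin.cons w z ∈ ball (0 : Fin (d+1) → ℂ) r ↔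
        w ∈ ball (0:ℂ) r ∧ z ∈ ball (0 : Fin d → ℂ) r := by
      intro w z
      simp [pi_norm_lt_iff hr, Fin.forall_fin_succ]
    let e0 : Fin (d+1) → ℂ := Fin.cons 1 0
    let D : ((Fin (d+1) → ℂ) → ℂ) → ((Fin (d+1) → ℂ) → ℂ) := fun h z => fderiv ℂ h z e0
    have hD : ∀ n, AnalyticOnNhd ℂ (D^[n] g) (ball 0 r) := by
      intro n
      induction n with
      | zero => exact hg
      | succ n ihn =>
        rw [Function.iterate_succ_apply']
        intro z hz
        have h3 : AnalyticAt ℂ (fderiv ℂ (D^[n] g)) z := ihn.fderiv z hz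
        exact ((ContinuousLinearMap.apply ℂ ℂ e0).analyticAt _).comp h3
    have hline : ∀ (z : Fin d → ℂ) (w : ℂ),
        HasDerivAt (fun w => (Fin.cons w z : Fin (d+1) → ℂ)) e0 w := by
      intro z w
      rw [hasDerivAt_pi]
      intro i
      refine Fin.cases ?_ (fun i => ?_) i
      · exact hasDerivAt_id w
      · exact hasDerivAt_const w (z i)
    have hcomp : ∀ n, ∀ z ∈ ball (0 : Fin d → ℂ) r, ∀ w ∈ ball (0:ℂ) r,
        HasDerivAt (fun w => (D^[n] g) (Fin.cons w z)) ((D^[n+1] g) (Fin.cons w z)) w := by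
      intro n z hz w hw
      rw [Function.iterate_succ_apply']
      exact ((hD n _ ((hcons w z).2 ⟨hw, hz⟩)).differentiableAt.hasFDerivAt).comp_hasDerivAt w
        (hline z w)
    have hiter : ∀ n, ∀ z ∈ ball (0 : Fin d → ℂ) r, ∀ w ∈ ball (0:ℂ) r,
        iteratedDeriv n (fun w => g (Fin.cons w z)) w = (D^[n] g) (Fin.cons w z) := by
      intro n
      induction n with
      | zero => intro z hz w hw; simp
      | succ n ihn =>
        intro z hz w hw
        rw [iteratedDeriv_succ]
        rw [Filter.EventuallyEq.deriv_eq (f := fun w => (D^[n] g) (Fin.cons w z))]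
        · exact (hcomp n z hz w hw).deriv
        · filter_upwards [isOpen_ball.mem_nhds hw] with y hy using ihn z hz y hy
    have hdiff : ∀ z ∈ ball (0 : Fin d → ℂ) r,
        DifferentiableOn ℂ (fun w => g (Fin.cons w z)) (ball 0 r) := fun z hz w hw =>
      (hcomp 0 z hz w hw).differentiableAt.differentiableWithinAt
    let b : ℕ → (Fin d → ℂ) → ℂ := fun n z => (n.factorial : ℂ)⁻¹ * (D^[n] g) (Fin.cons 0 z)
    have hb : ∀ n, AnalyticOnNhd ℂ (b n) (ball 0 r) := by
      intro n z hz
      refine analyticAt_const.mul ?_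
      have hlin : AnalyticAt ℂ (fun z : Fin d → ℂ => (Fin.cons 0 z : Fin (d+1) → ℂ)) z := by
        rw [analyticAt_pi_iff]
        intro i
        refine Fin.cases ?_ (fun i => ?_) i
        · exact analyticAt_const
        · exact (ContinuousLinearMap.proj (R := ℂ) (φ := fun _ : Fin d => ℂ) i).analyticAt z
      exact AnalyticAt.comp (g := D^[n] g) (hD n _ ((hcons 0 z).2 ⟨by simpa, hz⟩)) hlin
    have hbM : ∀ n, ∀ z ∈ ball (0 : Fin d → ℂ) r, ‖b n z‖ ≤ M / r ^ n := by
      intro n z hz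
      have key : ∀ s ∈ Ioo 0 r, ‖b n z‖ * s ^ n ≤ M := by
        intro s hs
        have hsub : closedBall (0:ℂ) s ⊆ ball 0 r := closedBall_subset_ball hs.2
        have := Complex.norm_iteratedDeriv_le_of_forall_mem_sphere_norm_le (C := M) n hs.1
          (f := fun w => g (Fin.cons w z)) (c := 0)
          (DifferentiableOn.diffContOnCl ((hdiff z hz).mono (closure_ball_subset_closedBall.trans hsub)))
          (fun w hw => hM _ ((hcons w z).2 ⟨hsub (sphere_subset_closedBall hw), hz⟩))
        rw [hiter n z hz 0 (by simpa)] at this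
        have hf : (0:ℝ) < n.factorial := by positivity
        have hsn : 0 < s ^ n := pow_pos hs.1 n
        simp only [b, norm_mul, norm_inv, Complex.norm_natCast]
        rw [le_div_iff₀ hsn] at this
        rw [mul_assoc, inv_mul_le_iff₀ hf]; exact this
      rw [le_div_iff₀ (pow_pos hr n)]
      have hc : ContinuousWithinAt (fun s : ℝ => ‖b n z‖ * s ^ n) (Ioo 0 r) r := by fun_prop
      have hcl : r ∈ closure (Ioo 0 r) := by
        rw [closure_Ioo hr.ne]; exact ⟨hr.le, le_rfl⟩
      exact ContinuousWithinAt.closure_le hcl hc continuousWithinAt_const key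
    choose a ha1 ha2 using fun n => ih (M / r ^ n) (b n) (hb n) (hbM n)
    refine ⟨fun α => a (α 0) (Fin.tail α), fun α => ?_, fun z hz => ?_⟩
    · have := ha1 (α 0) (Fin.tail α)
      rw [le_div_iff₀ (pow_pos hr _)] at this
      rw [Fin.sum_univ_succ, pow_add]
      simp only [Fin.tail] at this ⊢
      linarith
    · have hzc : z = Fin.cons (z 0) (Fin.tail z) := (Fin.cons_self_tail z).symm
      have hz2 := hz
      rw [hzc, hcons] at hz2
      obtain ⟨hz0, hzt⟩ := hz2
      rw [← (Fin.consEquiv (fun _ => ℕ)).hasSum_iff]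
      have hterm : ∀ x : ℕ × (Fin d → ℕ), ((fun α : Fin (d+1) → ℕ => a (α 0) (Fin.tail α) *
          ∏ i, z i ^ α i) ∘ (Fin.consEquiv (fun _ => ℕ))) x =
          z 0 ^ x.1 * (a x.1 x.2 * ∏ i, Fin.tail z i ^ x.2 i) := by
        intro x
        simp only [Fin.consEquiv, Function.comp, Equiv.coe_fn_mk, Fin.cons_zero, Fin.tail_cons,
          Fin.prod_univ_succ, Fin.cons_succ, Fin.tail]
        ring
      have hsm : Summable (fun x : ℕ × (Fin d → ℕ) =>
          z 0 ^ x.1 * (a x.1 x.2 * ∏ i, Fin.tail z i ^ x.2 i)) := by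
        have hS := (aux_summable (d+1) (fun i => ‖z i‖ / r) (fun i => by positivity)
          (fun i => (div_lt_one hr).2 (by
            rw [mem_ball_zero_iff, pi_norm_lt_iff hr] at hz; exact hz i))).mul_left M
        rw [← (Fin.consEquiv (fun _ => ℕ)).summable_iff] at hS
        refine Summable.of_norm_bounded hS fun x => ?_
        have h5 := ha1 x.1 x.2
        rw [le_div_iff₀ (pow_pos hr _)] at h5
        simp only [Fin.consEquiv, Function.comp, Equiv.coe_fn_mk, Fin.cons_zero,
          Fin.prod_univ_succ, Fin.cons_succ, Fin.tail, norm_mul, norm_pow, norm_prod, div_pow,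
          Finset.prod_div_distrib, Finset.prod_pow_eq_pow_sum, Fin.sum_univ_succ, pow_add]
        set P := ∏ i : Fin d, ‖z i.succ‖ ^ x.2 i
        have hP : 0 ≤ P := Finset.prod_nonneg fun i _ => by positivity
        have hrr : 0 < r ^ x.1 * r ^ (∑ i, x.2 i) := by positivity
        rw [mul_div_assoc', le_div_iff₀ hrr]
        calc _ = (‖a x.1 x.2‖ * r ^ (∑ i, x.2 i) * r ^ x.1) * (‖z 0‖ ^ x.1 * P) := by ring
          _ ≤ M * (‖z 0‖ ^ x.1 * P) := by gcongr
      rw [funext hterm]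
      have h6 : HasSum (fun n : ℕ => z 0 ^ n * b n (Fin.tail z)) (g z) := by
        have := Complex.hasSum_taylorSeries_on_ball (hdiff _ hzt) hz0
        rw [← hzc] at this
        suffices h8 : (fun n : ℕ => z 0 ^ n * b n (Fin.tail z)) = fun n : ℕ => (n.factorial : ℂ)⁻¹ •
            (z 0 - 0) ^ n • iteratedDeriv n (fun w => g (Fin.cons w (Fin.tail z))) 0 by
          rw [h8]; exact this
        funext n
        rw [hiter n _ hzt 0 (by simpa)]
        simp only [b, smul_eq_mul, sub_zero]
        ring
      have h7 := hsm.hasSum.prod_fiberwise (fun n => (ha2 n _ hzt).mul_left (z 0 ^ n))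
      rw [h6.unique h7]
      exact hsm.hasSum

theorem aux_mono {X Hs : Type*} {d : ℕ} [NormedAddCommGroup Hs] [NormedSpace ℂ Hs]
    (toF : Hs →ₗ[ℂ] (X → ℂ)) (c : ℝ) (hc : 0 < c)
    (L : Hs →L[ℂ] Hs →L[ℂ] Hs) (hL : ∀ u v x, toF (L u v) x = toF u x * toF v x)
    (hLn : ∀ u v, ‖L u v‖ ≤ c * ‖u‖ * ‖v‖) (n : ℕ) (α : Fin d → ℕ) (hα : ∑ i, α i = n + 1) :
    ∃ m : ContinuousMultilinearMap ℂ (fun _ : Fin (n+1) => (Fin d → Hs)) Hs,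
      ‖m‖ ≤ c ^ n ∧ ∀ (u : Fin d → Hs) (x : X), toF (m fun _ => u) x = ∏ i, toF (u i) x ^ α i := by
  have hex : ∃ j, 0 < α j := by
    by_contra! h
    have : ∑ i, α i = 0 := Finset.sum_eq_zero fun i _ => Nat.le_zero.1 (h i)
    omega
  obtain ⟨j, hj⟩ := hex
  have hsum : α j + ∑ i ∈ Finset.univ.erase j, α i = n + 1 := by
    rw [← hα]; exact Finset.add_sum_erase _ _ (Finset.mem_univ j)
  have hprod : ∀ (β : Fin d → ℕ) (z : Fin d → ℂ), ∏ i, z i ^ β i =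
      z j ^ β j * ∏ i ∈ Finset.univ.erase j, z i ^ β i := fun β z =>
    (Finset.mul_prod_erase _ _ (Finset.mem_univ j)).symm
  induction n generalizing α j with
  | zero =>
    refine ⟨(continuousMultilinearCurryFin1 ℂ (Fin d → Hs) Hs).symm (ContinuousLinearMap.proj j), ?_, ?_⟩
    · rw [LinearIsometryEquiv.norm_map, pow_zero]
      exact ContinuousLinearMap.opNorm_le_bound _ zero_le_one fun u => by
        simpa using norm_le_pi_norm u j
    · intro u x
      have h1 : α j = 1 := by omega
      have h0 : ∑ i ∈ Finset.univ.erase j, α i = 0 := by omega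
      rw [Finset.sum_eq_zero_iff] at h0
      rw [hprod α (fun i => toF (u i) x), h1, Finset.prod_eq_one (fun i hi => by rw [h0 i hi, pow_zero])]
      simp
  | succ n ih =>
    let β : Fin d → ℕ := Function.update α j (α j - 1)
    have hβe : ∀ i ∈ Finset.univ.erase j, β i = α i := fun i hi =>
      Function.update_of_ne (Finset.ne_of_mem_erase hi) _ _
    have hβj : β j = α j - 1 := Function.update_self _ _ _
    have hβ : ∑ i, β i = n + 1 := by
      rw [← Finset.add_sum_erase _ _ (Finset.mem_univ j), hβj, Finset.sum_congr rfl hβe]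
      have h9 : α j + (Finset.univ.erase j).sum α = n + 1 + 1 := hsum
      have h10 : (∑ x ∈ Finset.univ.erase j, α x) = (Finset.univ.erase j).sum α := rfl
      omega
    have hex : ∃ k, 0 < β k := by
      by_contra! h
      have : ∑ i, β i = 0 := Finset.sum_eq_zero fun i _ => Nat.le_zero.1 (h i)
      omega
    obtain ⟨k, hk⟩ := hex
    obtain ⟨m, hm1, hm2⟩ := ih β hβ k hk
      (by rw [← hβ]; exact Finset.add_sum_erase _ _ (Finset.mem_univ k))
      (fun β z => (Finset.mul_prod_erase _ _ (Finset.mem_univ k)).symm)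
    let T : (Fin d → Hs) →L[ℂ] ContinuousMultilinearMap ℂ (fun _ : Fin (n+1) => (Fin d → Hs)) Hs :=
      ((ContinuousLinearMap.compContinuousMultilinearMapL ℂ (fun _ : Fin (n+1) => (Fin d → Hs)) Hs Hs).flip m).comp
        (L.comp (ContinuousLinearMap.proj j))
    have hT : ∀ u v, T u v = L (u j) (m v) := fun u v => rfl
    refine ⟨ContinuousLinearMap.uncurryLeft (Ei := fun _ : Fin (n+2) => (Fin d → Hs)) T, ?_, ?_⟩
    · refine ContinuousMultilinearMap.opNorm_le_bound (by positivity) fun v => ?_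
      rw [ContinuousLinearMap.uncurryLeft_apply, hT, Fin.prod_univ_succ]
      have h1 := m.le_opNorm (Fin.tail v)
      calc _ ≤ c * ‖v 0 j‖ * ‖m (Fin.tail v)‖ := hLn _ _
        _ ≤ c * ‖v 0‖ * (c ^ n * ∏ i, ‖Fin.tail v i‖) := by
          gcongr
          · exact norm_le_pi_norm _ _
          · refine h1.trans ?_
            gcongr
        _ = _ := by simp only [Fin.tail]; ring
    · intro u x
      rw [ContinuousLinearMap.uncurryLeft_apply, hT, hL]
      have := hm2 u x
      change toF (u j) x * toF (m fun _ => u) x = _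
      rw [this, hprod β (fun i => toF (u i) x), hprod α (fun i => toF (u i) x), hβj,
        Finset.prod_congr rfl (fun i hi => by rw [hβe i hi]), ← mul_assoc, ← pow_succ']
      congr 2
      omega

theorem aux_bdd {E G : Type*} [NormedAddCommGroup E] [NormedSpace ℝ E]
    [NormedAddCommGroup G] [NormedSpace ℝ G] (F : E → G) (p : FormalMultilinearSeries ℝ E G)
    (r : NNReal) (R : ℝ) (hR : 0 ≤ R) (hRr : R < r) (h : HasFPowerSeriesOnBall F p 0 r) :
    ∃ C, ∀ x ∈ closedBall (0:E) R, ‖F x‖ ≤ C := by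
  lift R to NNReal using hR
  have hlt : (R : ENNReal) < p.radius :=
    lt_of_lt_of_le (by exact_mod_cast hRr) h.r_le
  have hs := p.summable_norm_mul_pow hlt
  refine ⟨∑' n, ‖p n‖ * (R:ℝ) ^ n, fun x hx => ?_⟩
  rw [mem_closedBall_zero_iff] at hx
  have hx' : x ∈ eball (0:E) r := by
    rw [eball_coe, mem_ball_zero_iff]; exact hx.trans_lt hRr
  have hsum := h.hasSum hx'
  rw [zero_add] at hsum
  have hb : ∀ n, ‖p n fun _ => x‖ ≤ ‖p n‖ * (R:ℝ) ^ n := by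
    intro n
    refine ((p n).le_opNorm _).trans ?_
    simp only [Finset.prod_const, Finset.card_univ, Fintype.card_fin]
    gcongr
  rw [← hsum.tsum_eq]
  exact tsum_of_norm_bounded hs.hasSum hb

theorem aux_iter {E G : Type*} [NormedAddCommGroup E] [NormedSpace ℝ E]
    [NormedAddCommGroup G] [NormedSpace ℝ G] [CompleteSpace G] (F : E → G)
    (p : FormalMultilinearSeries ℝ E G) (r : ENNReal) (h : HasFPowerSeriesOnBall F p 0 r) (k : ℕ) :
    ∃ q : FormalMultilinearSeries ℝ E (E [×k]→L[ℝ] G),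
      HasFPowerSeriesOnBall (iteratedFDeriv ℝ k F) q 0 r := by
  induction k with
  | zero =>
    rw [iteratedFDeriv_zero_eq_comp]
    exact ⟨_, ((continuousMultilinearCurryFin0 ℝ E G).symm.toContinuousLinearEquiv :
      G →L[ℝ] (E [×0]→L[ℝ] G)).comp_hasFPowerSeriesOnBall h⟩
  | succ k ih =>
    obtain ⟨q, hq⟩ := ih
    rw [iteratedFDeriv_succ_eq_comp_left]
    have h2 := HasFPowerSeriesOnBall.fderiv hq
    exact ⟨_, ((continuousMultilinearCurryLeftEquiv ℝ (fun _ : Fin (k+1) => E) G).symm.toContinuousLinearEquiv :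
      (E →L[ℝ] (E [×k]→L[ℝ] G)) →L[ℝ] (E [×(k+1)]→L[ℝ] G)).comp_hasFPowerSeriesOnBall h2⟩

theorem aux_component {X Hs : Type*} {d : ℕ} [NormedAddCommGroup Hs] [NormedSpace ℂ Hs]
    [CompleteSpace Hs]
    (toF : Hs →ₗ[ℂ] (X → ℂ)) (c : ℝ) (hc : 0 < c)
    (L : Hs →L[ℂ] Hs →L[ℂ] Hs) (hL : ∀ u v x, toF (L u v) x = toF u x * toF v x)
    (hLn : ∀ u v, ‖L u v‖ ≤ c * ‖u‖ * ‖v‖)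
    (hembed : ∀ (u : Hs) (x : X), ‖toF u x‖ ≤ c * ‖u‖)
    (a : (Fin d → ℕ) → ℂ) (r M : ℝ) (hr : 0 < r) (ha : ∀ α, ‖a α‖ * r ^ (∑ i, α i) ≤ M)
    (e : Hs) (he : (∀ x, toF e x = 1) ∨ a 0 = 0) (r' : NNReal) (hr' : 0 < r') (hcr : c * r' < r) :
    ∃ P : FormalMultilinearSeries ℂ (Fin d → Hs) Hs, HasFPowerSeriesOnBall P.sum P 0 r' ∧
      ∀ u : Fin d → Hs, ‖u‖ < r' → ∀ (x : X) (s : ℂ),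
        HasSum (fun α => a α * ∏ i, toF (u i) x ^ α i) s → toF (P.sum u) x = s := by
  have hB : ∀ (n : ℕ) (α : Fin d → ℕ),
      ∃ m : ContinuousMultilinearMap ℂ (fun _ : Fin n => (Fin d → Hs)) Hs, ∑ i, α i = n →
        ‖m‖ ≤ (‖e‖ + 1 / c) * c ^ n ∧ ∀ u x, a α * toF (m fun _ => u) x =
          a α * ∏ i, toF (u i) x ^ α i := by
    intro n α
    by_cases hα : ∑ i, α i = n
    swap
    · exact ⟨0, fun h => absurd h hα⟩
    cases n with
    | zero =>
      have h0 : α = 0 := by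
        funext i
        exact (Finset.sum_eq_zero_iff.1 hα) i (Finset.mem_univ i)
      subst h0
      refine ⟨ContinuousMultilinearMap.constOfIsEmpty ℂ _ e, fun _ => ⟨?_, fun u x => ?_⟩⟩
      · rw [ContinuousMultilinearMap.norm_constOfIsEmpty]
        have : 0 < 1 / c := by positivity
        simp only [pow_zero, mul_one]; linarith
      · rcases he with he | he
        · simp [he]
        · simp [he]
    | succ n =>
      obtain ⟨m, h1, h2⟩ := aux_mono toF c hc L hL hLn n α hα
      refine ⟨m, fun _ => ⟨h1.trans ?_, fun u x => by rw [h2]⟩⟩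
      have : (1 / c) * c ^ (n+1) = c ^ n := by rw [pow_succ]; field_simp
      rw [add_mul, this]
      have : 0 ≤ ‖e‖ * c ^ (n+1) := by positivity
      linarith
  choose m hm using hB
  let P : FormalMultilinearSeries ℂ (Fin d → Hs) Hs := fun n =>
    ∑ α ∈ Finset.piAntidiag Finset.univ n, a α • m n α
  have hmem : ∀ n (α : Fin d → ℕ), α ∈ Finset.piAntidiag Finset.univ n ↔ ∑ i, α i = n := by
    intro n α; simp
  set K := ‖e‖ + 1 / c with hK
  have hK0 : 0 ≤ K := by positivity
  set q := c * r' / r with hq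
  have hq0 : 0 ≤ q := by positivity
  have hq1 : q < 1 := (div_lt_one hr).2 hcr
  have hS : Summable (fun α : Fin d → ℕ => M * K * q ^ (∑ i, α i)) := by
    have := (aux_summable d (fun _ => q) (fun _ => hq0) (fun _ => hq1)).mul_left (M * K)
    simpa only [Finset.prod_pow_eq_pow_sum] using this
  have hM0 : 0 ≤ M := le_trans (by positivity) (ha 0)
  have hrad : (r' : ENNReal) ≤ P.radius := by
    refine P.le_radius_of_bound (∑' α : Fin d → ℕ, M * K * q ^ (∑ i, α i)) fun n => ?_
    refine le_trans ?_ (hS.sum_le_tsum (Finset.piAntidiag Finset.univ n) (fun α _ => by positivity))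
    refine (mul_le_mul_of_nonneg_right (norm_sum_le _ _) (by positivity)).trans ?_
    rw [Finset.sum_mul]
    refine Finset.sum_le_sum fun α hα => ?_
    rw [hmem] at hα
    rw [hα, norm_smul]
    have h1 := ha α
    rw [hα] at h1
    have h2 := (hm n α hα).1
    have h3 : ‖a α‖ ≤ M / r ^ n := by rwa [le_div_iff₀ (pow_pos hr n)]
    calc _ ≤ M / r ^ n * (K * c ^ n) * (r' : ℝ) ^ n := by gcongr
      _ = _ := by rw [hq, div_pow, mul_pow]; ring
  have hPb := (P.hasFPowerSeriesOnBall (lt_of_lt_of_le (by exact_mod_cast hr') hrad)).mono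
    (by exact_mod_cast hr') hrad
  refine ⟨P, hPb, fun u hu x s hs => ?_⟩
  let ev : Hs →L[ℂ] ℂ := ((LinearMap.proj x).comp toF).mkContinuous c (fun v => hembed v x)
  have hev : ∀ v, ev v = toF v x := fun v => rfl
  have h1 := hPb.hasSum (y := u) (by rw [eball_coe, mem_ball_zero_iff]; exact hu)
  rw [zero_add] at h1
  have h2 := h1.mapL ev
  have h3 := hs.tsum_fiberwise (fun α : Fin d → ℕ => ∑ i, α i)
  have h4 : (fun n => ev (P n fun _ => u)) = fun n => ∑' b : (fun α : Fin d → ℕ => ∑ i, α i) ⁻¹' {n},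
      (a b * ∏ i, toF (u i) x ^ (b : Fin d → ℕ) i) := by
    funext n
    have hset : (fun α : Fin d → ℕ => ∑ i, α i) ⁻¹' {n} =
        ((Finset.piAntidiag Finset.univ n : Finset (Fin d → ℕ)) : Set (Fin d → ℕ)) := by
      ext α; simp
    rw [hset, Finset.tsum_subtype' (Finset.piAntidiag Finset.univ n)
      (fun b : Fin d → ℕ => a b * ∏ i, toF (u i) x ^ b i)]
    simp only [P, ContinuousMultilinearMap.sum_apply, map_sum]
    refine Finset.sum_congr rfl fun α hα => ?_
    rw [hmem] at hα
    rw [← (hm n α hα).2 u x, ContinuousMultilinearMap.smul_apply, map_smul, hev, smul_eq_mul]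
  rw [h4] at h2
  rw [← hev]
  exact h2.unique h3

/-- **Superposition operators, analytic case** (Lemma 2.3 a)).  Let `Ω ⊆ ℝⁿ` be an
open set satisfying the cone property, `ρ > 0` and `f : 𝓑^ρ_{ℂ^d}(0) → ℂ^d`
analytic, with `f(0) = 0` when `Ω` is unbounded.  The Sobolev space `H_ℓ(Ω;ℂ)` with
`ℓ > n/2` is modelled abstractly as a Banach space `Hs` of functions on `Ω`
(realised through `toF`) which is closed under pointwise multiplication with the
algebra inequality `‖uv‖ ≤ c‖u‖‖v‖` and the Sobolev embedding `‖u(x)‖ ≤ c‖u‖`, and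
containing the constants when `Ω` is bounded; `H_ℓ(Ω;ℂ^d)` is `Fin d → Hs`.  Then
for every `R ≤ ρ/c` the superposition operator `u ↦ f ∘ u` is well defined and
analytic from the closed ball of radius `R` of `H_ℓ(Ω;ℂ^d)` to `H_ℓ(Ω;ℂ^d)`, and it
is bounded together with its derivatives up to order `N`, with `N`-dependent bounds,
for arbitrary `N ∈ ℕ`. -/
theorem superposition_operator_analytic
    {n d : ℕ} (Ω : Set (EuclideanSpace ℝ (Fin n)))
    (hΩ : IsOpen Ω) (hcone : HasConeProperty Ω)
    (Hs : Type*) [NormedAddCommGroup Hs] [NormedSpace ℂ Hs] [CompleteSpace Hs]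
    (toF : Hs →ₗ[ℂ] (Ω → ℂ)) (htoF : Function.Injective toF)
    (ℓ : ℝ) (hℓ : (n : ℝ) / 2 < ℓ)
    (c : ℝ) (hc : 0 < c)
    (mul : Hs → Hs → Hs)
    (hmul : ∀ (u v : Hs) (x : Ω), toF (mul u v) x = toF u x * toF v x)
    (hmul_norm : ∀ u v : Hs, ‖mul u v‖ ≤ c * ‖u‖ * ‖v‖)
    (hembed : ∀ (u : Hs) (x : Ω), ‖toF u x‖ ≤ c * ‖u‖)
    (hone : Bornology.IsBounded Ω → ∃ e : Hs, ∀ x : Ω, toF e x = 1)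
    (ρ : ℝ) (hρ : 0 < ρ)
    (f : (Fin d → ℂ) → (Fin d → ℂ)) (hf : AnalyticOn ℂ f (closedBall 0 ρ))
    (hf0 : ¬ Bornology.IsBounded Ω → f 0 = 0)
    (R : ℝ) (hR : 0 < R) (hRρ : R ≤ ρ / c) :
    ∃ F : (Fin d → Hs) → (Fin d → Hs),
      (∀ u ∈ closedBall (0 : Fin d → Hs) R, ∀ (x : Ω) (i : Fin d),
        toF (F u i) x = f (fun j => toF (u j) x) i) ∧
      AnalyticOn ℂ F (closedBall 0 R) ∧
      (∀ N : ℕ, ∃ C : ℝ, CbBound N F (closedBall (0 : Fin d → Hs) R) C) := by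
  have hmulL : ∀ u v : Hs, ∀ x, toF (mul u v) x = toF u x * toF v x := hmul
  let L0 : Hs →ₗ[ℂ] Hs →ₗ[ℂ] Hs := LinearMap.mk₂ ℂ mul
    (fun u v w => htoF (by funext x; simp [hmul, add_mul]))
    (fun a u v => htoF (by funext x; simp [hmul, mul_assoc]))
    (fun u v w => htoF (by funext x; simp [hmul, mul_add]))
    (fun a u v => htoF (by funext x; simp [hmul, mul_left_comm]))
  let L : Hs →L[ℂ] Hs →L[ℂ] Hs := L0.mkContinuous₂ c hmul_norm
  obtain ⟨ρ', hρ', g, hg, hgf⟩ := aux_extend f ρ hρ hf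
  obtain ⟨r, hr1, hr2⟩ := exists_between hρ'
  have hr : 0 < r := hρ.trans hr1
  have hsub : closedBall (0 : Fin d → ℂ) r ⊆ ball 0 ρ' := closedBall_subset_ball hr2
  obtain ⟨M, hM⟩ := (isCompact_closedBall (0 : Fin d → ℂ) r).exists_bound_of_continuousOn
    (hg.continuousOn.mono hsub)
  have hgi : ∀ i, AnalyticOnNhd ℂ (fun z => g z i) (ball 0 r) := fun i z hz =>
    analyticAt_pi_iff.1 (hg z (hsub (ball_subset_closedBall hz))) i
  choose a ha1 ha2 using fun i => aux_coeff r M hr d (fun z => g z i) (hgi i)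
    (fun z hz => (norm_le_pi_norm _ _).trans (hM z (ball_subset_closedBall hz)))
  have ha0 : ∀ i, a i 0 = f 0 i := by
    intro i
    rw [← hgf 0 (by simpa using hρ.le)]
    refine HasSum.unique ?_ (ha2 i 0 (by simpa))
    have := hasSum_single (f := fun α : Fin d → ℕ => a i α * ∏ j, (0 : Fin d → ℂ) j ^ α j) 0 ?_
    · simpa using this
    · intro α hα
      obtain ⟨j, hj⟩ := Function.ne_iff.1 hα
      have : ∏ j, (0 : Fin d → ℂ) j ^ α j = 0 :=
        Finset.prod_eq_zero (Finset.mem_univ j) (by simpa using hj)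
      rw [this, mul_zero]
  obtain ⟨e, he⟩ : ∃ e : Hs, (∀ x, toF e x = 1) ∨ ∀ i, a i 0 = 0 := by
    by_cases hb : Bornology.IsBounded Ω
    · obtain ⟨e, he⟩ := hone hb
      exact ⟨e, Or.inl he⟩
    · exact ⟨0, Or.inr fun i => by rw [ha0, hf0 hb]; rfl⟩
  have hcR : c * R ≤ ρ := by
    rw [le_div_iff₀ hc] at hRρ; linarith
  obtain ⟨r', hr'1, hr'2⟩ := exists_between (show R < r / c by
    rw [lt_div_iff₀ hc]; linarith)
  have hr'0 : 0 < r' := hR.trans hr'1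
  lift r' to NNReal using hr'0.le
  have hcr : c * r' < r := by rw [lt_div_iff₀ hc] at hr'2; linarith
  choose P hP1 hP2 using fun i => aux_component toF c hc L hmul hmul_norm hembed (a i) r M hr (ha1 i) e
    (he.imp id (fun h => h i)) r' (by exact_mod_cast hr'0) hcr
  have hF : HasFPowerSeriesOnBall (fun u i => (P i).sum u) (FormalMultilinearSeries.pi P) 0 r' :=
    HasFPowerSeriesOnBall.pi hP1 (by exact_mod_cast hr'0)
  have hsubR : closedBall (0 : Fin d → Hs) R ⊆ eball 0 r' := by
    rw [eball_coe]; exact closedBall_subset_ball hr'1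
  have hFan : AnalyticOnNhd ℂ (fun u i => (P i).sum u) (closedBall (0 : Fin d → Hs) R) :=
    hF.analyticOnNhd.mono hsubR
  refine ⟨fun u i => (P i).sum u, ?_, hFan.analyticOn, ?_⟩
  · intro u hu x i
    rw [mem_closedBall_zero_iff] at hu
    have hz : ‖fun j => toF (u j) x‖ ≤ ρ := by
      rw [pi_norm_le_iff_of_nonneg hρ.le]
      intro j
      refine (hembed _ _).trans (le_trans ?_ hcR)
      gcongr
      exact (norm_le_pi_norm u j).trans hu
    refine hP2 i u (hu.trans_lt hr'1) x _ ?_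
    rw [← hgf _ (mem_closedBall_zero_iff.2 hz)]
    exact ha2 i _ (mem_ball_zero_iff.2 (hz.trans_lt hr1))
  · intro N
    have hFr := hF.restrictScalars (𝕜 := ℝ)
    have hb : ∀ k : ℕ, ∃ C, ∀ x ∈ closedBall (0 : Fin d → Hs) R,
        ‖iteratedFDeriv ℝ k (fun (u : Fin d → Hs) i => (P i).sum u) x‖ ≤ C := by
      intro k
      obtain ⟨q, hq⟩ := aux_iter _ _ _ hFr k
      exact aux_bdd _ q r' R hR.le hr'1 hq
    choose C hC using hb
    refine ⟨∑ k ∈ Finset.range (N+1), |C k|, ?_, hFan.continuousOn, ?_⟩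
    · have : AnalyticOnNhd ℝ (fun (u : Fin d → Hs) i => (P i).sum u) (closedBall (0 : Fin d → Hs) R) :=
        hFr.analyticOnNhd.mono hsubR
      exact (this.mono interior_subset).contDiffOn isOpen_interior.uniqueDiffOn
    · intro k hk x hx
      rw [iteratedFDerivWithin_of_isOpen k isOpen_interior hx]
      refine (hC k x (interior_subset hx)).trans ((le_abs_self _).trans ?_)
      exact Finset.single_le_sum (f := fun k => |C k|) (fun k _ => abs_nonneg _)
        (Finset.mem_range.2 (by omega))

end
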